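/- Let k be the 1-periodic extension to ℝ of the function t ↦ (1/2)(1/2 − |t|)² on [−1/2, 1/2], let τ = (1/2)(1 − 1/√3), and let φ : [−τ, 1 − τ] → ℝ be continuous and strictly decreasing. Then ∫_{−τ}^{1−τ} k(t) φ(t) dt > (1/24) ∫_{−τ}^{1−τ} φ(t) dt. -/

import Mathlib

/-- The 1-periodic extension to ℝ of `t ↦ (1/2)(1/2 - |t|)^2` on `[-1/2, 1/2]`. -/
noncomputable def k (t : ℝ) : ℝ :=
  (1/2) * (1/2 - |Int.fract (t + 1/2) - 1/2|) ^ 2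

noncomputable def tau : ℝ := (1/2) * (1 - 1 / Real.sqrt 3)

theorem half_sub_tau_sq : (1 / 2 - tau) ^ 2 = 1 / 12 := by
  have h3 : Real.sqrt 3 ^ 2 = 3 := Real.sq_sqrt (by norm_num)
  have h : 1 / 2 - tau = 1 / 2 * (1 / Real.sqrt 3) := by unfold tau; ring
  rw [h, mul_pow, div_pow 1 (Real.sqrt 3), h3]
  norm_num

theorem tau_lt_half : tau < 1 / 2 := by
  have h : 0 < 1 / Real.sqrt 3 := by positivity
  unfold tau
  linarith

theorem tau_pos : 0 < tau := by
  nlinarith [half_sub_tau_sq, tau_lt_half]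

theorem k_eq_of_mem_Icc {t : ℝ} (ht : t ∈ Set.Icc (-tau) (1 - tau)) :
    k t = 1 / 2 * (1 / 2 - |t|) ^ 2 := by
  obtain ⟨h₁, h₂⟩ := ht
  have hτ := tau_lt_half
  have hτ' := tau_pos
  unfold k
  rcases lt_or_ge t (1 / 2) with h | h
  · rw [Int.fract_eq_self.mpr ⟨by linarith, by linarith⟩, add_sub_cancel_right]
  · have hf : Int.fract (t + 1 / 2) = t - 1 / 2 :=
      Int.fract_eq_iff.mpr ⟨by linarith, by linarith, 1, by push_cast; ring⟩
    rw [hf, abs_of_nonneg (by linarith : 0 ≤ t), abs_of_nonpos (by linarith)]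
    ring

theorem integral_half_sub_abs_sq :
    ∫ t in (-tau)..(1 - tau), 1 / 2 * (1 / 2 - |t|) ^ 2 = 1 / 24 := by
  have hτ := tau_lt_half
  have hτ' := tau_pos
  have hc : Continuous fun t : ℝ => 1 / 2 * (1 / 2 - |t|) ^ 2 := by fun_prop
  have hneg : ∫ t in (-tau)..0, 1 / 2 * (1 / 2 - |t|) ^ 2 =
      (1 / 2 + 0) ^ 3 / 6 - (1 / 2 + -tau) ^ 3 / 6 := by
    refine intervalIntegral.integral_eq_sub_of_hasDerivAt (f := fun t => (1 / 2 + t) ^ 3 / 6)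
      (fun t ht => ?_) (hc.intervalIntegrable _ _)
    rw [Set.uIcc_of_le (by linarith)] at ht
    rw [abs_of_nonpos ht.2]
    convert! (((hasDerivAt_id' t).const_add (1 / 2)).pow 3).div_const 6 using 1
    norm_num
    ring
  have hpos : ∫ t in (0)..(1 - tau), 1 / 2 * (1 / 2 - |t|) ^ 2 =
      (1 - tau - 1 / 2) ^ 3 / 6 - (0 - 1 / 2) ^ 3 / 6 := by
    refine intervalIntegral.integral_eq_sub_of_hasDerivAt (f := fun t => (t - 1 / 2) ^ 3 / 6)
      (fun t ht => ?_) (hc.intervalIntegrable _ _)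
    rw [Set.uIcc_of_le (by linarith)] at ht
    rw [abs_of_nonneg ht.1]
    convert! (((hasDerivAt_id' t).sub_const (1 / 2)).pow 3).div_const 6 using 1
    norm_num
    ring
  rw [← intervalIntegral.integral_add_adjacent_intervals (hc.intervalIntegrable _ 0)
    (hc.intervalIntegrable 0 _), hneg, hpos]
  ring

theorem half_sub_abs_sq_sub (t : ℝ) :
    1 / 2 * (1 / 2 - |t|) ^ 2 - 1 / 24 = 1 / 2 * ((tau - |t|) * (1 - tau - |t|)) := by
  linear_combination 1 / 2 * half_sub_tau_sq

theorem stmt_16 (φ : ℝ → ℝ)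
    (hcont : ContinuousOn φ (Set.Icc (-tau) (1 - tau)))
    (hanti : StrictAntiOn φ (Set.Icc (-tau) (1 - tau))) :
    (∫ t in (-tau)..(1 - tau), k t * φ t) >
      (1/24) * ∫ t in (-tau)..(1 - tau), φ t := by
  have hτ := tau_lt_half
  have hτ' := tau_pos
  have hle : -tau ≤ 1 - tau := by linarith
  have hmem : tau ∈ Set.Icc (-tau) (1 - tau) := ⟨by linarith, by linarith⟩
  have hmem₀ : (0 : ℝ) ∈ Set.Icc (-tau) (1 - tau) := ⟨by linarith, by linarith⟩
  set g : ℝ → ℝ := fun t => 1 / 2 * (1 / 2 - |t|) ^ 2 with hg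
  have hgc : Continuous g := by fun_prop
  have hpos : 0 < ∫ t in (-tau)..(1 - tau), (g t - 1 / 24) * (φ t - φ tau) := by
    refine intervalIntegral.integral_pos (by linarith)
      ((hgc.continuousOn.sub continuousOn_const).mul (hcont.sub continuousOn_const))
      (fun t ht => ?_) ⟨0, hmem₀, ?_⟩
    · have ht' : t ∈ Set.Icc (-tau) (1 - tau) := Set.Ioc_subset_Icc_self ht
      have habs : |t| ≤ 1 - tau := abs_le.mpr ⟨by linarith [ht'.1], ht'.2⟩
      simp only [hg, half_sub_abs_sq_sub]
      rcases le_total t tau with h | h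
      · have h₁ : |t| ≤ tau := abs_le.mpr ⟨ht'.1, h⟩
        exact mul_nonneg (mul_nonneg (by norm_num) (mul_nonneg (by linarith) (by linarith)))
          (sub_nonneg.mpr (hanti.antitoneOn ht' hmem h))
      · have h₁ : tau ≤ |t| := h.trans (le_abs_self t)
        exact mul_nonneg_of_nonpos_of_nonpos
          (mul_nonpos_of_nonneg_of_nonpos (by norm_num)
            (mul_nonpos_of_nonpos_of_nonneg (by linarith) (by linarith)))
          (sub_nonpos.mpr (hanti.antitoneOn hmem ht' h))
    · refine mul_pos ?_ (sub_pos.mpr (hanti hmem₀ hmem hτ'))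
      norm_num [hg]
  have hφi : IntervalIntegrable φ MeasureTheory.volume (-tau) (1 - tau) :=
    hcont.intervalIntegrable_of_Icc hle
  have hgφi : IntervalIntegrable (fun t => g t * φ t) MeasureTheory.volume (-tau) (1 - tau) :=
    (hgc.continuousOn.mul hcont).intervalIntegrable_of_Icc hle
  have hgi : IntervalIntegrable g MeasureTheory.volume (-tau) (1 - tau) :=
    hgc.intervalIntegrable _ _
  have hgint : ∫ t in (-tau)..(1 - tau), g t = 1 / 24 := integral_half_sub_abs_sq
  have hk : ∫ t in (-tau)..(1 - tau), k t * φ t = ∫ t in (-tau)..(1 - tau), g t * φ t := by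
    refine intervalIntegral.integral_congr fun t ht => ?_
    rw [Set.uIcc_of_le hle] at ht
    simp only [hg, k_eq_of_mem_Icc ht]
  have hexpand : ∫ t in (-tau)..(1 - tau), (g t - 1 / 24) * (φ t - φ tau) =
      (∫ t in (-tau)..(1 - tau), g t * φ t) - 1 / 24 * ∫ t in (-tau)..(1 - tau), φ t := by
    have h : ∀ t, (g t - 1 / 24) * (φ t - φ tau) =
        (g t * φ t - 1 / 24 * φ t) - (g t - 1 / 24) * φ tau := fun t => by ring
    simp only [h]
    rw [intervalIntegral.integral_sub (hgφi.sub (hφi.const_mul _))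
        ((hgi.sub intervalIntegrable_const).mul_const _),
      intervalIntegral.integral_sub hgφi (hφi.const_mul _),
      intervalIntegral.integral_const_mul, intervalIntegral.integral_mul_const,
      intervalIntegral.integral_sub hgi intervalIntegrable_const, hgint,
      intervalIntegral.integral_const]
    simp
  rw [hk]
  linarith
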